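/- Let H be a connected graded commutative Hopf algebra over ℂ, φ ∈ G_A a local character, and m, n ∈ ℤ with −n+2m ≥ 1. Set L_0 = R̃(φ), and let g_±(t) be pointwise differentiable curves with g_±(0) = ε furnishing the Birkhoff factorization exp(−2tλ^{−n+2m}L_0) = g_-(t)^{-1}⋆g_+(t). Then the Lax pair flow is constant: L(t) := Ad(g_±(t))L_0 = L_0 for all t; consequently the transferred flow of characters φ_t = R̃^{-1}(L(t)) equals φ, and β_{φ_t} = β_φ, for all t. -/

import Mathlib

open scoped TensorProduct

set_option synthInstance.maxHeartbeats 1000000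
set_option maxHeartbeats 1600000
set_option linter.unnecessarySeqFocus false

noncomputable section

/-- The algebra `A = ℂ((λ))` of formal Laurent series with finite pole part. -/
abbrev LS := LaurentSeries ℂ

/-- `ℂ`-scalars commute with multiplication of Laurent series. -/
instance : SMulCommClass ℂ LS LS := by
  constructor
  intro c a b
  show c • (a * b) = a * (c • b)
  rw [← HahnSeries.single_zero_mul_eq_smul, ← HahnSeries.single_zero_mul_eq_smul]
  ring

/-- Scalar tower for `ℂ`-scalars and Laurent series. -/
instance : IsScalarTower ℂ LS LS := by
  constructor
  intro c a b
  show (c • a) * b = c • (a * b)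
  rw [← HahnSeries.single_zero_mul_eq_smul, ← HahnSeries.single_zero_mul_eq_smul]
  ring

/-- `A₊ = ℂ[[λ]]`: the holomorphic part. -/
def Aplus (f : LS) : Prop := ∀ n : ℤ, n < 0 → f.coeff n = 0

/-- `A₋ = λ⁻¹ℂ[λ⁻¹]`: the polar part. -/
def Aminus (f : LS) : Prop := ∀ n : ℤ, 0 ≤ n → f.coeff n = 0

/-- The formal variable `λ`. -/
def lam : LS := HahnSeries.single (1 : ℤ) (1 : ℂ)

/-- `λ^k` for `k : ℤ`. -/
def lamZ (k : ℤ) : LS := HahnSeries.single k (1 : ℂ)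

/-- `e^{cλ} = Σ_k c^k λ^k / k!` as a Laurent series. -/
def expL (c : ℂ) : LS :=
  HahnSeries.ofPowerSeries ℤ ℂ (PowerSeries.mk fun k => c ^ k / (k.factorial : ℂ))

section Hopf

variable {H : Type} [Ring H] [HopfAlgebra ℂ H]

/-- Convolution product of linear maps from a Hopf algebra to `A`. -/
def conv (f g : H →ₗ[ℂ] LS) : H →ₗ[ℂ] LS :=
  LinearMap.mul' ℂ LS ∘ₗ TensorProduct.map f g ∘ₗ Coalgebra.comul

/-- The unit `ε` of the convolution algebra. -/
def epsA : H →ₗ[ℂ] LS := LinearMap.toSpanSingleton ℂ LS 1 ∘ₗ Coalgebra.counit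

/-- Characters: algebra morphisms `H → A` sending `1` to `1`. -/
def IsCharacter (φ : H →ₗ[ℂ] LS) : Prop :=
  φ 1 = 1 ∧ ∀ x y : H, φ (x * y) = φ x * φ y

/-- The group inverse of a character: `φ⁻¹ = φ ∘ S`. -/
def charInv (φ : H →ₗ[ℂ] LS) : H →ₗ[ℂ] LS := φ ∘ₗ HopfAlgebra.antipode (R := ℂ)

/-- Infinitesimal characters: `Z(xy) = Z(x)ε(y) + ε(x)Z(y)`. -/
def IsInfChar (Z : H →ₗ[ℂ] LS) : Prop :=
  ∀ x y : H, Z (x * y) = Z x * epsA y + epsA x * Z y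

/-- The Lie bracket `[Z,Z'] = Z⋆Z' − Z'⋆Z` on infinitesimal characters. -/
def lieBr (Z W : H →ₗ[ℂ] LS) : H →ₗ[ℂ] LS := conv Z W - conv W Z

/-- The adjoint action `Ad(g)L = g⋆L⋆g⁻¹`. -/
def Adc (g L : H →ₗ[ℂ] LS) : H →ₗ[ℂ] LS := conv g (conv L (charInv g))

/-- Convolution powers `Z^{⋆k}`. -/
def convPow (Z : H →ₗ[ℂ] LS) : ℕ → (H →ₗ[ℂ] LS)
  | 0 => epsA
  | k + 1 => conv Z (convPow Z k)

/-- `E = exp(Z)`, the convolution exponential: for each `x ∈ H` the series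
`Σ_k Z^{⋆k}(x)/k!` stabilizes (a finite sum by connectedness) with value `E(x)`. -/
def IsConvExp (Z E : H →ₗ[ℂ] LS) : Prop :=
  ∀ x : H, ∃ N : ℕ, ∀ M : ℕ, N ≤ M →
    E x = ∑ k ∈ Finset.range M, ((k.factorial : ℂ))⁻¹ • convPow Z k x

/- ℂ-valued (scalar) versions, for `β`-functions. -/

/-- Convolution product of ℂ-valued linear maps on a Hopf algebra. -/
def convC (f g : H →ₗ[ℂ] ℂ) : H →ₗ[ℂ] ℂ :=
  LinearMap.mul' ℂ ℂ ∘ₗ TensorProduct.map f g ∘ₗ Coalgebra.comul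

/-- ℂ-valued characters. -/
def IsCharacterC (φ : H →ₗ[ℂ] ℂ) : Prop :=
  φ 1 = 1 ∧ ∀ x y : H, φ (x * y) = φ x * φ y

/-- The group inverse of a ℂ-valued character. -/
def charInvC (φ : H →ₗ[ℂ] ℂ) : H →ₗ[ℂ] ℂ := φ ∘ₗ HopfAlgebra.antipode (R := ℂ)

/-- ℂ-valued infinitesimal characters. -/
def IsInfCharC (Z : H →ₗ[ℂ] ℂ) : Prop :=
  ∀ x y : H, Z (x * y) = Z x * Coalgebra.counit y + Coalgebra.counit x * Z y

end Hopf

section Graded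

variable {H : Type} [Ring H] [HopfAlgebra ℂ H]
variable (𝒜 : ℕ → Submodule ℂ H) [GradedAlgebra 𝒜]

/-- Connectedness: `H₀ = ℂ·1`. -/
def IsConnectedGrading : Prop := 𝒜 0 = Submodule.span ℂ {(1 : H)}

/-- The coproduct is grading-preserving: `Δ(H_n) ⊆ Σ_{i+j=n} H_i ⊗ H_j`. -/
def ComulGraded : Prop :=
  ∀ n : ℕ, ∀ x ∈ 𝒜 n, Coalgebra.comul (R := ℂ) x ∈
    ⨆ p : {p : ℕ × ℕ // p.1 + p.2 = n},
      LinearMap.range (TensorProduct.map ((𝒜 p.1.1).subtype) ((𝒜 p.1.2).subtype))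

/-- The counit is grading-preserving: it vanishes in positive degrees. -/
def CounitGraded : Prop := ∀ n : ℕ, 0 < n → ∀ x ∈ 𝒜 n, Coalgebra.counit (R := ℂ) x = 0

/-- The antipode is grading-preserving. -/
def AntipodeGraded : Prop := ∀ n : ℕ, ∀ x ∈ 𝒜 n, HopfAlgebra.antipode (R := ℂ) x ∈ 𝒜 n

/-- The grading biderivation `Y(x) = n·x` for `x ∈ H_n`. -/
def Ymap : H →ₗ[ℂ] H :=
  (DFinsupp.lsum ℕ fun n : ℕ => ((n : ℂ) • (𝒜 n).subtype)) ∘ₗ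
    (DirectSum.decomposeLinearEquiv 𝒜).toLinearMap

/-- `φ^t`, defined by `φ^t(x) = e^{tλn}·φ(x)` for homogeneous `x` of degree `n`. -/
def charScale (t : ℂ) (φ : H →ₗ[ℂ] LS) : H →ₗ[ℂ] LS :=
  (DFinsupp.lsum ℕ fun n : ℕ => (expL (t * (n : ℂ)) • (φ ∘ₗ (𝒜 n).subtype))) ∘ₗ
    (DirectSum.decomposeLinearEquiv 𝒜).toLinearMap

/-- `R̃(φ) = φ^{-1} ⋆ (φ ∘ Y)`. -/
def Rtilde (φ : H →ₗ[ℂ] LS) : H →ₗ[ℂ] LS := conv (charInv φ) (φ ∘ₗ Ymap 𝒜)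

/-- `(φm, φp)` is the Birkhoff decomposition of `φ`: `φ = φm^{-1} ⋆ φp`, i.e. `φm ⋆ φ = φp`,
with `φp` holomorphic and `φm − ε` a pure pole part. -/
def IsBirkhoff (φ φm φp : H →ₗ[ℂ] LS) : Prop :=
  IsCharacter φm ∧ IsCharacter φp ∧ (∀ x, Aplus (φp x)) ∧
    (∀ x, Aminus (φm x - epsA x)) ∧ conv φm φ = φp

/-- A character is local if the negative Birkhoff part of `φ^t` is independent of `t`. -/
def IsLocal (φ : H →ₗ[ℂ] LS) : Prop :=
  IsCharacter φ ∧ ∃ φm : H →ₗ[ℂ] LS, ∀ t : ℂ, ∃ φp, IsBirkhoff (charScale 𝒜 t φ) φm φp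

/-- `B = tildeβ_φ`:  `B(x) = (d/dt)|_{t=0} (φ^{-1} ⋆ φ^t)(x)`, coefficientwise. -/
def HasTildeBeta (φ B : H →ₗ[ℂ] LS) : Prop :=
  ∀ (x : H) (n : ℤ),
    HasDerivAt (fun t : ℂ => ((conv (charInv φ) (charScale 𝒜 t φ)) x).coeff n)
      ((B x).coeff n) 0

/-- The `β`-function `β_φ = −(Res φ₋) ∘ Y` of a local character whose negative
Birkhoff part is `φm`. -/
def betaFn (φm : H →ₗ[ℂ] LS) : H → ℂ := fun x => -((φm (Ymap 𝒜 x)).coeff (-1))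

end Graded

section Curves

variable {H : Type} [Ring H] [HopfAlgebra ℂ H]

/-- Pointwise (coefficientwise) derivative of a curve of maps `H → A`. -/
def HasDerivAtF (F : ℝ → (H →ₗ[ℂ] LS)) (F' : H →ₗ[ℂ] LS) (t : ℝ) : Prop :=
  ∀ (x : H) (n : ℤ), HasDerivAt (fun s : ℝ => ((F s) x).coeff n) ((F' x).coeff n) t

/-- Pointwise differentiability of a curve of maps `H → A`. -/
def PointwiseDifferentiable (F : ℝ → (H →ₗ[ℂ] LS)) : Prop :=
  ∀ (x : H) (n : ℤ), Differentiable ℝ (fun s : ℝ => ((F s) x).coeff n)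

end Curves

/-- The operator `R = P₊ − P₋` on Laurent series. -/
def Rop : LS →ₗ[ℂ] LS where
  toFun f :=
    { coeff := fun n => if n < 0 then -f.coeff n else f.coeff n
      isPWO_support' := f.isPWO_support'.mono (by
        intro n hn
        simp only [Function.mem_support] at hn ⊢
        by_cases h : n < 0 <;> simp_all) }
  map_add' f g := by
    ext n
    by_cases h : n < 0 <;> simp [h] <;> ring
  map_smul' c f := by
    ext n
    by_cases h : n < 0 <;> simp [h]


namespace LaxAux

open Coalgebra HopfAlgebra

section basic

theorem epsA_apply {H : Type} [Ring H] [HopfAlgebra ℂ H] (x : H) :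
    (epsA x : LS) = (counit (R := ℂ) x) • (1 : LS) := by
  simp [epsA]

variable {H : Type} [Ring H] [HopfAlgebra ℂ H]

theorem conv_repr (f g : H →ₗ[ℂ] LS) (x : H) {ι : Type} (r : Coalgebra.Repr ℂ x ι) :
    conv f g x = ∑ i ∈ r.index, f (r.left i) * g (r.right i) := by
  simp [conv, ← r.eq]

theorem conv_assoc (f g h : H →ₗ[ℂ] LS) : conv (conv f g) h = conv f (conv g h) :=
  congrArg WithConv.ofConv
    (mul_assoc (WithConv.toConv f) (WithConv.toConv g) (WithConv.toConv h))

theorem eps_conv (f : H →ₗ[ℂ] LS) : conv epsA f = f := by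
  ext1 x
  rw [conv_repr _ _ _ (ℛ ℂ x)]
  conv_rhs => rw [← Coalgebra.sum_counit_smul (ℛ ℂ x)]
  simp [epsA_apply]

theorem conv_eps (f : H →ₗ[ℂ] LS) : conv f epsA = f := by
  ext1 x
  rw [conv_repr _ _ _ (ℛ ℂ x)]
  have h2 := congrArg (TensorProduct.rid ℂ H) (Coalgebra.sum_tmul_counit_eq (ℛ ℂ x))
  simp only [map_sum, TensorProduct.rid_tmul, one_smul] at h2
  conv_rhs => rw [← h2]
  simp [epsA_apply]

theorem conv_sub_left (f f' g : H →ₗ[ℂ] LS) : conv (f - f') g = conv f g - conv f' g := by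
  ext1 x
  simp [conv_repr _ _ _ (ℛ ℂ x), sub_mul]

theorem conv_add_left (f f' g : H →ₗ[ℂ] LS) : conv (f + f') g = conv f g + conv f' g := by
  ext1 x
  simp [conv_repr _ _ _ (ℛ ℂ x), add_mul, Finset.sum_add_distrib]

theorem conv_add_right (f g g' : H →ₗ[ℂ] LS) : conv f (g + g') = conv f g + conv f g' := by
  ext1 x
  simp [conv_repr _ _ _ (ℛ ℂ x), mul_add, Finset.sum_add_distrib]

theorem conv_smul_left (a : LS) (f g : H →ₗ[ℂ] LS) : conv (a • f) g = a • conv f g := by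
  ext1 x
  simp [conv_repr _ _ _ (ℛ ℂ x), Finset.mul_sum, mul_assoc]

theorem conv_smul_right (a : LS) (f g : H →ₗ[ℂ] LS) : conv f (a • g) = a • conv f g := by
  ext1 x
  simp [conv_repr _ _ _ (ℛ ℂ x), Finset.mul_sum, mul_left_comm]

theorem conv_csmul_left (a : ℂ) (f g : H →ₗ[ℂ] LS) : conv (a • f) g = a • conv f g := by
  ext1 x
  simp only [conv_repr _ _ _ (ℛ ℂ x), Finset.smul_sum, LinearMap.smul_apply, smul_mul_assoc]

theorem conv_csmul_right (a : ℂ) (f g : H →ₗ[ℂ] LS) : conv f (a • g) = a • conv f g := by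
  ext1 x
  simp only [conv_repr _ _ _ (ℛ ℂ x), Finset.smul_sum, LinearMap.smul_apply, mul_smul_comm]

theorem conv_mem (p : AddSubmonoid LS) (f g : H →ₗ[ℂ] LS) (h : ∀ a b, f a * g b ∈ p) (x : H) :
    conv f g x ∈ p := by
  rw [conv_repr _ _ _ (ℛ ℂ x)]
  exact sum_mem fun i _ => h _ _

theorem char_algMap {f : H →ₗ[ℂ] LS} (hf : IsCharacter f) (x : H) :
    f (algebraMap ℂ H (counit (R := ℂ) x)) = epsA x := by
  rw [Algebra.algebraMap_eq_smul_one, map_smul, hf.1, epsA_apply]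

theorem inv_conv {f : H →ₗ[ℂ] LS} (hf : IsCharacter f) : conv (charInv f) f = epsA := by
  ext1 x
  rw [conv_repr _ _ _ (ℛ ℂ x), ← char_algMap hf, ← sum_antipode_mul_eq_algebraMap_counit (ℛ ℂ x)]
  simp [charInv, hf.2]

theorem conv_inv {f : H →ₗ[ℂ] LS} (hf : IsCharacter f) : conv f (charInv f) = epsA := by
  ext1 x
  rw [conv_repr _ _ _ (ℛ ℂ x), ← char_algMap hf, ← sum_mul_antipode_eq_algebraMap_counit (ℛ ℂ x)]
  simp [charInv, hf.2]

theorem eps_char : IsCharacter (epsA : H →ₗ[ℂ] LS) := by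
  constructor
  · simp [epsA_apply]
  · intro x y
    simp only [epsA_apply, Bialgebra.counit_mul, smul_mul_assoc, mul_smul, one_mul]

theorem charInv_eps : charInv (epsA : H →ₗ[ℂ] LS) = epsA := by
  ext1 x
  simp [charInv, epsA_apply]

end basic

section comm
variable {H : Type} [CommRing H] [HopfAlgebra ℂ H]

theorem charInv_char {f : H →ₗ[ℂ] LS} (hf : IsCharacter f) : IsCharacter (charInv f) := by
  constructor
  · simp [charInv, hf.1]
  · intro x y
    simp [charInv, hf.2, antipode_mul_distrib]

theorem conv_char {f g : H →ₗ[ℂ] LS} (hf : IsCharacter f) (hg : IsCharacter g) :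
    IsCharacter (conv f g) := by
  constructor
  · simp [conv, hf.1, hg.1, Algebra.TensorProduct.one_def]
  · intro x y
    rw [conv_repr f g x (ℛ ℂ x), conv_repr f g y (ℛ ℂ y)]
    simp only [conv, LinearMap.comp_apply, Bialgebra.comul_mul]
    conv_lhs => rw [← (ℛ ℂ x).eq, ← (ℛ ℂ y).eq]
    simp only [Finset.sum_mul_sum, map_sum, Algebra.TensorProduct.tmul_mul_tmul,
      TensorProduct.map_tmul, LinearMap.mul'_apply, hf.2, hg.2]
    refine Finset.sum_congr rfl fun i _ => Finset.sum_congr rfl fun j _ => ?_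
    ring

end comm

section parts

def plusS : AddSubmonoid LS where
  carrier := {f | Aplus f}
  zero_mem' := fun n _ => by simp
  add_mem' := fun {a b} ha hb n hn => by simp [ha n hn, hb n hn]

def minusS : AddSubmonoid LS where
  carrier := {f | Aminus f}
  zero_mem' := fun n _ => by simp
  add_mem' := fun {a b} ha hb n hn => by simp [ha n hn, hb n hn]

theorem plus_mul {a b : LS} (ha : Aplus a) (hb : Aplus b) : Aplus (a * b) := by
  intro n hn
  rw [HahnSeries.coeff_mul]
  refine Finset.sum_eq_zero fun ij hij => ?_
  simp only [Finset.mem_antidiagonal] at hij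
  by_cases h : ij.1 < 0
  · rw [ha _ h, zero_mul]
  · rw [hb _ (by omega), mul_zero]

theorem minus_mul {a b : LS} (ha : Aminus a) (hb : Aminus b) : Aminus (a * b) := by
  intro n hn
  rw [HahnSeries.coeff_mul]
  refine Finset.sum_eq_zero fun ij hij => ?_
  simp only [Finset.mem_antidiagonal] at hij
  by_cases h : 0 ≤ ij.1
  · rw [ha _ h, zero_mul]
  · rw [hb _ (by omega), mul_zero]

theorem csmul_coeff (c : ℂ) (a : LS) (n : ℤ) : (c • a).coeff n = c * a.coeff n := by
  simp

theorem plus_csmul (c : ℂ) {a : LS} (ha : Aplus a) : Aplus (c • a) := by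
  intro n hn
  rw [csmul_coeff, ha n hn, mul_zero]

theorem plus_one : Aplus (1 : LS) := by
  intro n hn
  simp [HahnSeries.coeff_one, hn.ne]

theorem plus_sub {a b : LS} (ha : Aplus a) (hb : Aplus b) : Aplus (a - b) := by
  intro n hn
  rw [HahnSeries.coeff_sub, ha n hn, hb n hn, sub_zero]

theorem plus_minus {a : LS} (h : Aplus a) (h' : Aminus a) : a = 0 := by
  ext n
  by_cases hn : n < 0
  · simpa using h n hn
  · simpa using h' n (by omega)

variable {H : Type} [Ring H] [HopfAlgebra ℂ H]

theorem plus_eps (x : H) : Aplus (epsA x) := by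
  rw [epsA_apply]; exact plus_csmul _ plus_one

theorem plus_conv {f g : H →ₗ[ℂ] LS} (hf : ∀ x, Aplus (f x)) (hg : ∀ x, Aplus (g x)) (x : H) :
    Aplus (conv f g x) :=
  conv_mem plusS f g (fun a b => plus_mul (hf a) (hg b)) x

theorem minus_conv {f g : H →ₗ[ℂ] LS} (hf : ∀ x, Aminus (f x)) (hg : ∀ x, Aminus (g x)) (x : H) :
    Aminus (conv f g x) :=
  conv_mem minusS f g (fun a b => minus_mul (hf a) (hg b)) x

/-- Uniqueness of Birkhoff decompositions. -/
theorem birkhoff_unique {φ a b a' b' : H →ₗ[ℂ] LS} (hφ : IsCharacter φ)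
    (h : IsBirkhoff φ a b) (h' : IsBirkhoff φ a' b') : a = a' := by
  obtain ⟨ha, hb, hbp, ham, e⟩ := h
  obtain ⟨ha', hb', hbp', ham', e'⟩ := h'
  have key : conv a' (charInv a) = conv b' (charInv b) := by
    have h1 : conv (charInv a) b = φ := by rw [← e, ← conv_assoc, inv_conv ha, eps_conv]
    have h2 : conv φ (charInv b) = charInv a := by
      rw [← h1, conv_assoc, conv_inv hb, conv_eps]
    rw [← h2, ← conv_assoc, e']
  set f := a' - epsA with hf
  set g := charInv a - epsA with hg
  have hfm : ∀ x, Aminus (f x) := fun x => ham' x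
  have hgm : ∀ x, Aminus (g x) := fun x => by
    have := ham (antipode ℂ x)
    simpa [g, charInv, epsA_apply] using this
  have e1 : conv a' (charInv a) = epsA + (f + g + conv f g) := by
    have : a' = epsA + f := by rw [hf]; abel
    rw [this]
    have : charInv a = epsA + g := by rw [hg]; abel
    rw [this]
    simp only [conv_add_left, conv_add_right, eps_conv, conv_eps]
    abel
  have e2 : f + g + conv f g = 0 := by
    ext1 x
    refine plus_minus ?_ ?_
    · have : (f + g + conv f g) x = conv b' (charInv b) x - epsA x := by
        rw [← key, e1, LinearMap.add_apply epsA, add_sub_cancel_left]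
      rw [this]
      exact plus_sub (plus_conv hbp' (fun y => hbp (antipode ℂ y)) x) (plus_eps x)
    · exact minusS.add_mem (minusS.add_mem (hfm x) (hgm x)) (minus_conv hfm hgm x)
  rw [e2, add_zero] at e1
  calc a = conv epsA a := (eps_conv a).symm
    _ = conv a' (conv (charInv a) a) := by rw [← e1, conv_assoc]
    _ = a' := by rw [inv_conv ha, conv_eps]

end parts

section expo
variable {H : Type} [Ring H] [HopfAlgebra ℂ H]

theorem convPow_plus {Z : H →ₗ[ℂ] LS} (hZ : ∀ x, Aplus (Z x)) (k : ℕ) : ∀ x, Aplus (convPow Z k x) := by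
  induction k with
  | zero => exact plus_eps
  | succ k ih => exact plus_conv hZ ih

theorem exp_plus {Z E : H →ₗ[ℂ] LS} (hE : IsConvExp Z E) (hZ : ∀ x, Aplus (Z x)) (x : H) :
    Aplus (E x) := by
  obtain ⟨N, hN⟩ := hE x
  rw [hN N le_rfl]
  exact plusS.sum_mem fun k _ => plus_csmul _ (convPow_plus hZ k x)

theorem convPow_comm {Z L : H →ₗ[ℂ] LS} (h : conv Z L = conv L Z) (k : ℕ) :
    conv (convPow Z k) L = conv L (convPow Z k) := by
  induction k with
  | zero => simp [convPow, eps_conv, conv_eps]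
  | succ k ih => rw [convPow, conv_assoc, ih, ← conv_assoc, h, conv_assoc]

theorem exp_comm {Z E L : H →ₗ[ℂ] LS} (hE : IsConvExp Z E) (h : conv Z L = conv L Z) :
    conv E L = conv L E := by
  ext1 x
  choose N hN using hE
  set r := ℛ ℂ x
  set M := r.index.sup (fun i => max (N (r.left i)) (N (r.right i))) with hM
  have h1 : ∀ i ∈ r.index, N (r.left i) ≤ M ∧ N (r.right i) ≤ M := fun i hi => by
    have := Finset.le_sup (f := fun i => max (N (r.left i)) (N (r.right i))) hi
    exact ⟨(le_max_left _ _).trans this, (le_max_right _ _).trans this⟩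
  have e1 : conv E L x = ∑ k ∈ Finset.range M,
      ((k.factorial : ℂ))⁻¹ • conv (convPow Z k) L x := by
    simp only [conv_repr _ _ x r, Finset.smul_sum]
    rw [Finset.sum_comm]
    refine Finset.sum_congr rfl fun i hi => ?_
    rw [hN _ M (h1 i hi).1, Finset.sum_mul]
    simp only [smul_mul_assoc]
  have e2 : conv L E x = ∑ k ∈ Finset.range M,
      ((k.factorial : ℂ))⁻¹ • conv L (convPow Z k) x := by
    simp only [conv_repr _ _ x r, Finset.smul_sum]
    rw [Finset.sum_comm]
    refine Finset.sum_congr rfl fun i hi => ?_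
    rw [hN _ M (h1 i hi).2, Finset.mul_sum]
    simp only [mul_smul_comm]
  rw [e1, e2]
  simp only [convPow_comm h]

end expo


section scale

theorem expL_mul_coeff (a : ℂ) (c : LS) (n : ℤ) :
    (expL a * c).coeff n = if n - c.order < 0 then 0 else
      ∑ p ∈ Finset.HasAntidiagonal.antidiagonal (n - c.order).natAbs,
        (a ^ p.1 / (p.1.factorial : ℂ)) * PowerSeries.coeff p.2 c.powerSeriesPart := by
  conv_lhs => rw [← LaurentSeries.single_order_mul_powerSeriesPart c]
  rw [mul_left_comm, HahnSeries.coeff_single_mul, one_mul, expL, ← map_mul]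
  rw [PowerSeries.coeff_coe]
  split_ifs
  · rfl
  · rw [PowerSeries.coeff_mul]
    simp

theorem coeff_eq_part (c : LS) (n : ℤ) :
    c.coeff n = if n - c.order < 0 then 0 else
      PowerSeries.coeff (n - c.order).natAbs c.powerSeriesPart := by
  conv_lhs => rw [← LaurentSeries.single_order_mul_powerSeriesPart c]
  rw [HahnSeries.coeff_single_mul, one_mul, PowerSeries.coeff_coe]

theorem expL_zero : expL 0 = 1 := by
  have : (PowerSeries.mk fun k => (0 : ℂ) ^ k / (k.factorial : ℂ)) = 1 := by
    ext k
    cases k <;> simp [PowerSeries.coeff_one]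
  rw [expL, this, map_one]

theorem deriv_term (k q : ℂ) (i : ℕ) :
    HasDerivAt (fun t : ℂ => ((t * k) ^ i / (i.factorial : ℂ)) * q)
      (if i = 1 then k * q else 0) 0 := by
  have h := ((((hasDerivAt_id (0 : ℂ)).mul_const k).pow i).div_const (i.factorial : ℂ)).mul_const q
  refine h.congr_deriv ?_
  rcases i with _ | _ | i <;> simp

theorem expL_deriv (k : ℂ) (c : LS) (n : ℤ) :
    HasDerivAt (fun t : ℂ => (expL (t * k) * c).coeff n) (k * c.coeff (n - 1)) 0 := by
  simp only [expL_mul_coeff]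
  rw [coeff_eq_part c (n - 1)]
  by_cases h : n - c.order < 0
  · rw [if_pos (by omega)]
    simp only [if_pos h, mul_zero]
    exact hasDerivAt_const _ _
  · simp only [if_neg h]
    have h1 := HasDerivAt.fun_sum (u := Finset.HasAntidiagonal.antidiagonal (n - c.order).natAbs)
      (fun p _ => deriv_term k (PowerSeries.coeff p.2 c.powerSeriesPart) p.1)
    refine h1.congr_deriv (Eq.symm ?_)
    obtain ⟨d, hd⟩ := Int.eq_ofNat_of_zero_le (not_lt.mp h)
    rw [hd]
    rcases d with _ | d
    · rw [if_pos (by omega)]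
      simp
    · rw [if_neg (by omega)]
      rw [Finset.sum_eq_single (1, d)]
      · have : (n - 1 - c.order).natAbs = d := by omega
        simp [this]
      · rintro ⟨i, j⟩ hij hne
        simp only [Finset.HasAntidiagonal.mem_antidiagonal, Int.natAbs_natCast] at hij
        rw [if_neg]
        rintro rfl
        exact hne (by ext <;> simp; omega)
      · intro hn
        exact absurd (by simp; omega) hn

variable {H : Type} [Ring H] [HopfAlgebra ℂ H]
variable (𝒜 : ℕ → Submodule ℂ H) [GradedAlgebra 𝒜]

theorem Ymap_hom {k : ℕ} {x : H} (hx : x ∈ 𝒜 k) : Ymap 𝒜 x = (k : ℂ) • x := by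
  lift x to 𝒜 k using hx
  have h : DirectSum.decomposeLinearEquiv 𝒜 (x : H) = DFinsupp.single k x :=
    DirectSum.decompose_coe 𝒜 x
  simp only [Ymap, LinearMap.comp_apply, LinearEquiv.coe_coe, h]
  erw [DFinsupp.lsum_single]
  rfl

theorem charScale_hom (t : ℂ) (φ : H →ₗ[ℂ] LS) {k : ℕ} {x : H} (hx : x ∈ 𝒜 k) :
    charScale 𝒜 t φ x = expL (t * k) * φ x := by
  lift x to 𝒜 k using hx
  have h : DirectSum.decomposeLinearEquiv 𝒜 (x : H) = DFinsupp.single k x :=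
    DirectSum.decompose_coe 𝒜 x
  simp only [charScale, LinearMap.comp_apply, LinearEquiv.coe_coe, h]
  erw [DFinsupp.lsum_single]
  rfl

theorem charScale_zero (φ : H →ₗ[ℂ] LS) : charScale 𝒜 0 φ = φ := by
  ext1 x
  induction x using DirectSum.Decomposition.inductionOn 𝒜 with
  | zero => simp
  | homogeneous x => rw [charScale_hom 𝒜 0 φ x.2]; simp [expL_zero]
  | add a b ha hb => rw [map_add, map_add, ha, hb]

theorem scale_deriv (f φ : H →ₗ[ℂ] LS) (z : H ⊗[ℂ] H) (n : ℤ) :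
    HasDerivAt (fun t : ℂ =>
      (LinearMap.mul' ℂ LS (TensorProduct.map f (charScale 𝒜 t φ) z)).coeff n)
      ((LinearMap.mul' ℂ LS (TensorProduct.map f (φ ∘ₗ Ymap 𝒜) z)).coeff (n - 1)) 0 := by
  induction z using TensorProduct.induction_on with
  | zero => simpa using hasDerivAt_const (0 : ℂ) (0 : ℂ)
  | add a b ha hb =>
    simp only [map_add, HahnSeries.coeff_add]
    exact ha.add hb
  | tmul a b =>
    simp only [TensorProduct.map_tmul, LinearMap.mul'_apply]
    induction b using DirectSum.Decomposition.inductionOn 𝒜 with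
    | zero => simpa using hasDerivAt_const (0 : ℂ) (0 : ℂ)
    | add b b' hb hb' =>
      simp only [map_add, mul_add, HahnSeries.coeff_add]
      exact hb.add hb'
    | @homogeneous k b =>
      have h := expL_deriv k (f a * φ b) n
      simp only [charScale_hom 𝒜 _ φ b.2, LinearMap.comp_apply, Ymap_hom 𝒜 b.2, map_smul]
      simp only [mul_left_comm (f a), mul_smul_comm, csmul_coeff]
      exact h

theorem lam_Rtilde_plus {φ : H →ₗ[ℂ] LS} (hloc : IsLocal 𝒜 φ) (k : ℤ) (hk : 1 ≤ k) (x : H) :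
    Aplus ((lamZ k • Rtilde 𝒜 φ) x) := by
  obtain ⟨hφ, φm, h⟩ := hloc
  have h1 : ∀ x, Aplus ((lamZ k • conv φm (φ ∘ₗ Ymap 𝒜)) x) := by
    intro x n hn
    have hd := scale_deriv 𝒜 φm φ (comul x) (n - k + 1)
    have h0 : (fun t : ℂ => (LinearMap.mul' ℂ LS
        (TensorProduct.map φm (charScale 𝒜 t φ) (comul x))).coeff (n - k + 1)) = fun _ => 0 := by
      funext t
      obtain ⟨φp, hb⟩ := h t
      have := hb.2.2.1 x
      rw [← hb.2.2.2.2] at this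
      exact this _ (by omega)
    rw [h0] at hd
    have := hd.unique (hasDerivAt_const _ _)
    rw [LinearMap.smul_apply, smul_eq_mul, lamZ, HahnSeries.coeff_single_mul, one_mul]
    rw [add_sub_cancel_right] at this
    exact this
  obtain ⟨φp, hm, hp, hpp, -, e⟩ := h 0
  rw [charScale_zero] at e
  have e2 : charInv φ = conv (charInv φp) φm := by
    have : conv (conv (charInv φp) φm) φ = epsA := by rw [conv_assoc, e, inv_conv hp]
    calc charInv φ = conv (conv (conv (charInv φp) φm) φ) (charInv φ) := by rw [this, eps_conv]
      _ = _ := by rw [conv_assoc, conv_inv hφ, conv_eps]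
  have e3 : lamZ k • Rtilde 𝒜 φ = conv (charInv φp) (lamZ k • conv φm (φ ∘ₗ Ymap 𝒜)) := by
    rw [conv_smul_right, ← conv_assoc, ← e2, Rtilde]
  rw [e3]
  exact plus_conv (fun y => hpp (antipode ℂ y)) h1 x

theorem Rtilde_zero (hconn : IsConnectedGrading 𝒜) {f : H →ₗ[ℂ] LS} {x : H} (hx : x ∈ 𝒜 0) :
    Rtilde 𝒜 f x = 0 := by
  rw [hconn] at hx
  obtain ⟨c, rfl⟩ := Submodule.mem_span_singleton.mp hx
  have : Ymap 𝒜 1 = 0 := by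
    rw [Ymap_hom 𝒜 (SetLike.GradedOne.one_mem : (1 : H) ∈ 𝒜 0)]; simp
  simp [Rtilde, conv, Algebra.TensorProduct.one_def, this]

theorem Rtilde_inj (hconn : IsConnectedGrading 𝒜) (hΔ : ComulGraded 𝒜) {f g : H →ₗ[ℂ] LS}
    (hf : IsCharacter f) (hg : IsCharacter g) (h : Rtilde 𝒜 f = Rtilde 𝒜 g) : f = g := by
  have ef : f ∘ₗ Ymap 𝒜 = conv f (Rtilde 𝒜 g) := by
    rw [← h, Rtilde, ← conv_assoc, conv_inv hf, eps_conv]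
  have eg : g ∘ₗ Ymap 𝒜 = conv g (Rtilde 𝒜 g) := by
    rw [Rtilde, ← conv_assoc, conv_inv hg, eps_conv]
  have key : ∀ n : ℕ, ∀ x ∈ 𝒜 n, f x = g x := by
    intro n
    induction n using Nat.strong_induction_on with
    | _ n ih =>
    intro x hx
    rcases Nat.eq_zero_or_pos n with rfl | hn
    · rw [hconn] at hx
      obtain ⟨c, rfl⟩ := Submodule.mem_span_singleton.mp hx
      rw [map_smul, map_smul, hf.1, hg.1]
    · have hle : (⨆ p : {p : ℕ × ℕ // p.1 + p.2 = n},
          LinearMap.range (TensorProduct.map ((𝒜 p.1.1).subtype) ((𝒜 p.1.2).subtype))) ≤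
          LinearMap.eqLocus (LinearMap.mul' ℂ LS ∘ₗ TensorProduct.map f (Rtilde 𝒜 g))
            (LinearMap.mul' ℂ LS ∘ₗ TensorProduct.map g (Rtilde 𝒜 g)) := by
        refine iSup_le ?_
        rintro ⟨⟨i, j⟩, hij⟩ _ ⟨w, rfl⟩
        rw [LinearMap.mem_eqLocus]
        induction w using TensorProduct.induction_on with
        | zero => simp
        | add a b ha hb => rw [map_add, map_add, map_add, ha, hb]
        | tmul a b =>
          simp only [LinearMap.comp_apply, TensorProduct.map_tmul, LinearMap.mul'_apply,
            Submodule.subtype_apply]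
          simp only at hij a b
          rcases Nat.eq_zero_or_pos j with rfl | hj
          · rw [Rtilde_zero 𝒜 hconn b.2, mul_zero, mul_zero]
          · rw [ih i (by omega) a a.2]
      have e : conv f (Rtilde 𝒜 g) x = conv g (Rtilde 𝒜 g) x := hle (hΔ n x hx)
      rw [← ef, ← eg, LinearMap.comp_apply, LinearMap.comp_apply, Ymap_hom 𝒜 hx,
        map_smul, map_smul] at e
      exact smul_right_injective LS (Nat.cast_ne_zero.mpr hn.ne' : (n : ℂ) ≠ 0) e
  ext1 x
  induction x using DirectSum.Decomposition.inductionOn 𝒜 with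
  | zero => simp
  | homogeneous x => exact key _ _ x.2
  | add a b ha hb => rw [map_add, map_add, ha, hb]

end scale

end LaxAux

/-- **Theorem.** Let `H` be a connected graded commutative Hopf algebra, `φ` a
local character, and `−n+2m ≥ 1`.  Set `L₀ = R̃(φ)` and let `g_±(t)` furnish
the Birkhoff factorization `exp(−2tλ^{−n+2m}L₀) = g₋(t)⁻¹ ⋆ g₊(t)`, with
`g_±(0) = ε`.  Then the Lax pair flow is constant:
`L(t) = Ad(g_±(t))L₀ = L₀` for all `t`; consequently the transferred flow of
characters `φ_t = R̃⁻¹(L(t))` equals `φ`, and `β_{φ_t} = β_φ`, for all `t`. -/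
theorem lax_flow_constant_for_positive_weight
    {H : Type} [CommRing H] [HopfAlgebra ℂ H]
    (𝒜 : ℕ → Submodule ℂ H) [GradedAlgebra 𝒜]
    (hconn : IsConnectedGrading 𝒜) (hΔ : ComulGraded 𝒜)
    (hcounit : CounitGraded 𝒜) (hS : AntipodeGraded 𝒜)
    (m n : ℤ) (hmn : 1 ≤ -n + 2 * m)
    (φ : H →ₗ[ℂ] LS) (hloc : IsLocal 𝒜 φ)
    (gm gp : ℝ → (H →ₗ[ℂ] LS))
    (hgmchar : ∀ t, IsCharacter (gm t)) (hgpchar : ∀ t, IsCharacter (gp t))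
    (hgm0 : gm 0 = epsA) (hgp0 : gp 0 = epsA)
    (hgpplus : ∀ t x, Aplus (gp t x))
    (hgmminus : ∀ t x, Aminus (gm t x - epsA x))
    (hdm : PointwiseDifferentiable gm) (hdp : PointwiseDifferentiable gp)
    (hfact : ∀ t : ℝ,
      IsConvExp ((-(2 * (t : ℂ))) • (lamZ (-n + 2 * m) • Rtilde 𝒜 φ))
        (conv (charInv (gm t)) (gp t)))
    (φt : ℝ → (H →ₗ[ℂ] LS)) (hφtchar : ∀ t, IsCharacter (φt t))
    (hφtR : ∀ t : ℝ, Rtilde 𝒜 (φt t) = Adc (gp t) (Rtilde 𝒜 φ)) :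
    (∀ t : ℝ, Adc (gp t) (Rtilde 𝒜 φ) = Rtilde 𝒜 φ ∧
      Adc (gm t) (Rtilde 𝒜 φ) = Rtilde 𝒜 φ) ∧
    (∀ t : ℝ, φt t = φ) ∧
    (∀ (t : ℝ) (φtm φtp φm φp : H →ₗ[ℂ] LS),
      IsBirkhoff (φt t) φtm φtp → IsBirkhoff φ φm φp →
      betaFn 𝒜 φtm = betaFn 𝒜 φm) := by
  have hφ : IsCharacter φ := hloc.1
  set L := Rtilde 𝒜 φ with hL
  have hZ : ∀ (t : ℝ) (x : H), Aplus (((-(2 * (t : ℂ))) • (lamZ (-n + 2 * m) • L)) x) :=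
    fun t x => LaxAux.plus_csmul _ (LaxAux.lam_Rtilde_plus 𝒜 hloc _ hmn x)
  have hEchar : ∀ t, IsCharacter (conv (charInv (gm t)) (gp t)) := fun t =>
    LaxAux.conv_char (LaxAux.charInv_char (hgmchar t)) (hgpchar t)
  have hgm : ∀ t, gm t = epsA := by
    intro t
    refine LaxAux.birkhoff_unique (hEchar t)
      (b := gp t) (b' := conv (charInv (gm t)) (gp t)) ?_ ?_
    · refine ⟨hgmchar t, hgpchar t, hgpplus t, hgmminus t, ?_⟩
      rw [← LaxAux.conv_assoc, LaxAux.conv_inv (hgmchar t), LaxAux.eps_conv]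
    · refine ⟨LaxAux.eps_char, hEchar t, LaxAux.exp_plus (hfact t) (hZ t), ?_, LaxAux.eps_conv _⟩
      intro x k _
      simp
  have hcomm : ∀ t, conv (gp t) L = conv L (gp t) := by
    intro t
    have h := LaxAux.exp_comm (hfact t) (L := L) (by
      simp only [LaxAux.conv_csmul_left, LaxAux.conv_csmul_right, LaxAux.conv_smul_left,
        LaxAux.conv_smul_right])
    rwa [hgm t, LaxAux.charInv_eps, LaxAux.eps_conv] at h
  have hAd : ∀ t, Adc (gp t) L = L := by
    intro t
    rw [Adc, ← LaxAux.conv_assoc, hcomm, LaxAux.conv_assoc, LaxAux.conv_inv (hgpchar t),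
      LaxAux.conv_eps]
  have hφt : ∀ t, φt t = φ := fun t =>
    LaxAux.Rtilde_inj 𝒜 hconn hΔ (hφtchar t) hφ ((hφtR t).trans (hAd t))
  refine ⟨fun t => ⟨hAd t, ?_⟩, hφt, ?_⟩
  · rw [hgm t, Adc, LaxAux.charInv_eps, LaxAux.eps_conv, LaxAux.conv_eps]
  · intro t φtm φtp φm φp h1 h2
    rw [hφt t] at h1
    rw [LaxAux.birkhoff_unique hφ h1 h2]

end
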